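/- For every $q\in\mathbb{R}$ and every $\varepsilon>0$, $\mathscr{P}^{q,\tau_\mu(q)-\varepsilon}_\nu([0,1])>0$; consequently $B_\nu(q)\ge\tau_\mu(q)$. -/

import Mathlib

open MeasureTheory Metric Set Filter Topology Classical
open scoped ENNReal NNReal

noncomputable section

namespace MF

/-! ### Olsen's multifractal measures and dimension functions on a metric space -/

variable {X : Type} [MetricSpace X]

/-- The sum `∑ m(B(xᵢ,rᵢ))^q (2rᵢ)^t` associated with a countable family of centered balls. -/
def olsenSum [MeasurableSpace X] (m : Measure X) (q t : ℝ) {ι : Type}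
    (c : ι → X) (r : ι → ℝ) : ℝ≥0∞ :=
  ∑' i, m (closedBall (c i) (r i)) ^ q * ENNReal.ofReal (2 * r i) ^ t

/-- `Olsen's 𝓗^{q,t}_{m,δ}`: infimum over countable centered `δ`-coverings of `E`. -/
def Hdel [MeasurableSpace X] (m : Measure X) (q t δ : ℝ) (E : Set X) : ℝ≥0∞ :=
  ⨅ (ι : Type) (_ : Countable ι) (c : ι → X) (r : ι → ℝ)
    (_ : ∀ i, c i ∈ E) (_ : ∀ i, 0 < r i ∧ r i ≤ δ)
    (_ : E ⊆ ⋃ i, closedBall (c i) (r i)), olsenSum m q t c r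

/-- Olsen's premeasure `𝓗̄^{q,t}_m` (limit, i.e. supremum, as `δ ↓ 0`). -/
def Hpre [MeasurableSpace X] (m : Measure X) (q t : ℝ) (E : Set X) : ℝ≥0∞ :=
  ⨆ (δ : ℝ) (_ : 0 < δ), Hdel m q t δ E

/-- Olsen's multifractal Hausdorff measure `𝓗^{q,t}_m`. -/
def Hmeas [MeasurableSpace X] (m : Measure X) (q t : ℝ) (E : Set X) : ℝ≥0∞ :=
  ⨆ (F : Set X) (_ : F ⊆ E), Hpre m q t F

/-- `𝓟̄^{q,t}_{m,δ}`: supremum over countable centered `δ`-packings of `E`. -/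
def Pdel [MeasurableSpace X] (m : Measure X) (q t δ : ℝ) (E : Set X) : ℝ≥0∞ :=
  ⨆ (ι : Type) (_ : Countable ι) (c : ι → X) (r : ι → ℝ)
    (_ : ∀ i, c i ∈ E) (_ : ∀ i, 0 < r i ∧ r i ≤ δ)
    (_ : ∀ i j, i ≠ j → Disjoint (closedBall (c i) (r i)) (closedBall (c j) (r j))),
    olsenSum m q t c r

/-- Olsen's packing premeasure `𝓟̄^{q,t}_m` (limit, i.e. infimum, as `δ ↓ 0`). -/
def Ppre [MeasurableSpace X] (m : Measure X) (q t : ℝ) (E : Set X) : ℝ≥0∞ :=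
  ⨅ (δ : ℝ) (_ : 0 < δ), Pdel m q t δ E

/-- Olsen's multifractal packing measure `𝓟^{q,t}_m`. -/
def Pmeas [MeasurableSpace X] (m : Measure X) (q t : ℝ) (E : Set X) : ℝ≥0∞ :=
  ⨅ (En : ℕ → Set X) (_ : E ⊆ ⋃ n, En n), ∑' n, Ppre m q t (En n)

/-- The (topological) support of a measure on a metric space. -/
def msupport [MeasurableSpace X] (m : Measure X) : Set X :=
  {x | ∀ r : ℝ, 0 < r → 0 < m (ball x r)}

/-- Olsen's multifractal Hausdorff dimension function `b_m`. -/
def bFun [MeasurableSpace X] (m : Measure X) (q : ℝ) : ℝ :=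
  sInf {t | Hmeas m q t (msupport m) = 0}

/-- Olsen's multifractal packing dimension function `B_m`. -/
def BFun [MeasurableSpace X] (m : Measure X) (q : ℝ) : ℝ :=
  sInf {t | Pmeas m q t (msupport m) = 0}

/-- Olsen's function `τ_m`. -/
def tauFun [MeasurableSpace X] (m : Measure X) (q : ℝ) : ℝ :=
  sInf {t | Ppre m q t (msupport m) = 0}

/-- `t`-dimensional packing pre-premeasure at scale `δ`. -/
def pPdel (t δ : ℝ) (E : Set X) : ℝ≥0∞ :=
  ⨆ (ι : Type) (_ : Countable ι) (c : ι → X) (r : ι → ℝ)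
    (_ : ∀ i, c i ∈ E) (_ : ∀ i, 0 < r i ∧ r i ≤ δ)
    (_ : ∀ i j, i ≠ j → Disjoint (closedBall (c i) (r i)) (closedBall (c j) (r j))),
    ∑' i, ENNReal.ofReal (2 * r i) ^ t

/-- `t`-dimensional packing premeasure. -/
def pPpre (t : ℝ) (E : Set X) : ℝ≥0∞ := ⨅ (δ : ℝ) (_ : 0 < δ), pPdel t δ E

/-- `t`-dimensional packing measure. -/
def pPmeas (t : ℝ) (E : Set X) : ℝ≥0∞ :=
  ⨅ (En : ℕ → Set X) (_ : E ⊆ ⋃ n, En n), ∑' n, pPpre t (En n)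

/-- Packing dimension of a set. -/
def packDim (E : Set X) : ℝ := sInf {t | pPmeas t E = 0}

/-- The level set `X_m(α)` of points of the support where the local Hölder exponent is `α`. -/
def Xlev [MeasurableSpace X] (m : Measure X) (α : ℝ) : Set X :=
  {x | x ∈ msupport m ∧
    Tendsto (fun r => Real.log (m (closedBall x r)).toReal / Real.log r)
      (𝓝[>] (0 : ℝ)) (𝓝 α)}

/-- Legendre transform `f^*(x) = inf_y (xy + f(y))`. -/
def leg (f : ℝ → ℝ) (x : ℝ) : ℝ := ⨅ y : ℝ, (x * y + f y)

/-! ### The mixed symbolic space and inhomogeneous multinomial measures -/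

/-- `j` is an index governed by the first alphabet:
`T (2k-1) ≤ j < T (2k)` for some `k ≥ 1`. -/
def isA (T : ℕ → ℕ) (j : ℕ) : Prop :=
  ∃ k, 1 ≤ k ∧ T (2 * k - 1) ≤ j ∧ j < T (2 * k)

/-- The size of the alphabet at (0-based) position `n`, i.e. at paper index `j = n+1`. -/
def Yc (c₁ c₂ : ℕ) (T : ℕ → ℕ) (n : ℕ) : ℕ := if isA T (n + 1) then c₁ else c₂

/-- The mixed symbolic space `∂𝒜₁,₂* = ∏ⱼ Yⱼ`. -/
abbrev Omg (c₁ c₂ : ℕ) (T : ℕ → ℕ) : Type := ∀ n : ℕ, Fin (Yc c₁ c₂ T n)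

/-- Finite words of length `n`. -/
abbrev Word (c₁ c₂ : ℕ) (T : ℕ → ℕ) (n : ℕ) : Type :=
  ∀ i : Fin n, Fin (Yc c₁ c₂ T i.val)

/-- `N_n`: the number of indices `1 ≤ j ≤ n` governed by the first alphabet. -/
def Ncount (T : ℕ → ℕ) (n : ℕ) : ℕ := ((Finset.Icc 1 n).filter (isA T)).card

/-- Diameter `c₁^{-N_n} c₂^{-(n-N_n)}` of a cylinder of generation `n`. -/
def Dw (c₁ c₂ : ℕ) (T : ℕ → ℕ) (n : ℕ) : ℝ :=
  ((c₁ : ℝ) ^ Ncount T n * (c₂ : ℝ) ^ (n - Ncount T n))⁻¹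

/-- The cylinder `[w]` defined by a finite word `w`. -/
def cyl (c₁ c₂ : ℕ) (T : ℕ → ℕ) (n : ℕ) (w : Word c₁ c₂ T n) : Set (Omg c₁ c₂ T) :=
  {x | ∀ i : Fin n, x i.val = w i}

/-- The mass `∏_{j≤n} p_j` given to the cylinder `[w]` by the inhomogeneous
multinomial measure with weights `a` and `b`. -/
def cylWeight (c₁ c₂ : ℕ) (T : ℕ → ℕ) (a b : ℕ → ℝ) (n : ℕ) (w : Word c₁ c₂ T n) : ℝ :=
  ∏ i : Fin n, (if isA T (i.val + 1) then a (w i).val else b (w i).val)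

/-- `θ(q) = log_c (p₁^q + ⋯ + p_c^q)`. -/
def theta (c : ℕ) (p : ℕ → ℝ) (q : ℝ) : ℝ :=
  Real.logb c (∑ i ∈ Finset.range c, p i ^ q)

/-- `τ_{μ,n}(q)`, defined by `∑_{z ∈ 𝒜₁,₂ⁿ} μ([z])^q = |w|^{-τ_{μ,n}(q)}`. -/
def tauN (c₁ c₂ : ℕ) (T : ℕ → ℕ) (a b : ℕ → ℝ) (q : ℝ) (n : ℕ) : ℝ :=
  Real.log (∑ z : Word c₁ c₂ T n, cylWeight c₁ c₂ T a b n z ^ q) /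
    Real.log ((c₁ : ℝ) ^ Ncount T n * (c₂ : ℝ) ^ (n - Ncount T n))

/-- The natural projection `γ : ∂𝒜₁,₂* → [0,1]`,
`γ(ε₁ε₂⋯) = ∑_{n≥1} εₙ c₁^{-N_n} c₂^{-(n-N_n)}`. -/
def gammaMap (c₁ c₂ : ℕ) (T : ℕ → ℕ) (x : Omg c₁ c₂ T) : ℝ :=
  ∑' n : ℕ, ((x n).val : ℝ) * Dw c₁ c₂ T (n + 1)

/-- The normalized weights `pᵢ^q / (p₁^q + ⋯ + p_c^q)`. -/
def taW (c : ℕ) (p : ℕ → ℝ) (q : ℝ) (i : ℕ) : ℝ :=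
  p i ^ q / ∑ j ∈ Finset.range c, p j ^ q

/-- `s₁ = min{max aᵢ, max bⱼ}`. -/
def sOne (c₁ c₂ : ℕ) (a b : ℕ → ℝ) : ℝ :=
  min (sSup {x | ∃ i < c₁, a i = x}) (sSup {x | ∃ j < c₂, b j = x})

/-- `s₂ = max{min aᵢ, min bⱼ}`. -/
def sTwo (c₁ c₂ : ℕ) (a b : ℕ → ℝ) : ℝ :=
  max (sInf {x | ∃ i < c₁, a i = x}) (sInf {x | ∃ j < c₂, b j = x})

/-- Entropy `h(p) = -∑_{i<2} pᵢ log₂ pᵢ`. -/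
def hEnt (p : ℕ → ℝ) : ℝ := -(∑ i ∈ Finset.range 2, p i * Real.logb 2 (p i))

/-! ### Dyadic intervals -/

/-- The family `𝓕_n` of dyadic intervals of generation `n` in `[0,1]`. -/
def Fnfam (n : ℕ) : Set (Set ℝ) :=
  {I | ∃ j : ℕ, j < 2 ^ n ∧ I = Set.Icc ((j : ℝ) / 2 ^ n) (((j : ℝ) + 1) / 2 ^ n)}

/-- Index of the dyadic interval of generation `n` containing `x`
(the left one when `x` is dyadic). -/
def dyadIdx (n : ℕ) (x : ℝ) : ℤ := ⌈x * 2 ^ n⌉ - 1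

/-- `I_n(x)`: the dyadic interval of generation `n` containing `x`
(the left one when `x` is dyadic). -/
def Idyad (n : ℕ) (x : ℝ) : Set ℝ :=
  Set.Icc ((dyadIdx n x : ℝ) / 2 ^ n) (((dyadIdx n x : ℝ) + 1) / 2 ^ n)

/-- `I_n(x)⁺`: the right neighbour of `I_n(x)` in `𝓕_n`. -/
def IdyadP (n : ℕ) (x : ℝ) : Set ℝ :=
  Set.Icc (((dyadIdx n x : ℝ) + 1) / 2 ^ n) (((dyadIdx n x : ℝ) + 2) / 2 ^ n)

/-- `I_n(x)⁻`: the left neighbour of `I_n(x)` in `𝓕_n`. -/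
def IdyadM (n : ℕ) (x : ℝ) : Set ℝ :=
  Set.Icc (((dyadIdx n x : ℝ) - 1) / 2 ^ n) ((dyadIdx n x : ℝ) / 2 ^ n)

/-! ### Mixed radix expansions -/

section Expansion

variable {c : ℕ → ℕ}

/-- The length `∏_{i<n} c_i⁻¹` of the intervals of generation `n`. -/
def scale (c : ℕ → ℕ) (n : ℕ) : ℝ := ∏ i ∈ Finset.range n, (c i : ℝ)⁻¹

/-- The real number with mixed radix digits `x`. -/
def expansion (x : ∀ n, Fin (c n)) : ℝ := ∑' n, ((x n).val : ℝ) * scale c (n + 1)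

/-- The truncation of `expansion x` to its first `n` digits. -/
def prefixSum (x : ∀ n, Fin (c n)) (n : ℕ) : ℝ :=
  ∑ i ∈ Finset.range n, ((x i).val : ℝ) * scale c (i + 1)

/-- The integer whose mixed radix digits are the first `n` digits of `x`. -/
def prefixIndex (x : ∀ n, Fin (c n)) : ℕ → ℕ
  | 0 => 0
  | n + 1 => c n * prefixIndex x n + (x n).val

/-- The cylinder of a finite word. -/
def prefixCyl {n : ℕ} (z : ∀ i : Fin n, Fin (c i)) : Set (∀ n, Fin (c n)) :=
  {x | ∀ i : Fin n, x i.val = z i}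

/-- The sequences whose digits in `[n, n + m)` are neither all minimal nor all maximal. -/
def innerPoints (c : ℕ → ℕ) (n m : ℕ) : Set (∀ n, Fin (c n)) :=
  {x | (∃ i, n ≤ i ∧ i < n + m ∧ (x i).val ≠ 0) ∧
    ∃ i, n ≤ i ∧ i < n + m ∧ (x i).val + 1 ≠ c i}

lemma scale_pos (hc : ∀ n, 2 ≤ c n) (n : ℕ) : 0 < scale c n :=
  Finset.prod_pos fun i _ => inv_pos.2 (by have := hc i; positivity)

lemma scale_eq_mul_succ (hc : ∀ n, 2 ≤ c n) (n : ℕ) : scale c n = c n * scale c (n + 1) := by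
  have h : (c n : ℝ) ≠ 0 := by have := hc n; positivity
  rw [scale, scale, Finset.prod_range_succ]
  field_simp

lemma two_mul_scale_succ_le (hc : ∀ n, 2 ≤ c n) (n : ℕ) : 2 * scale c (n + 1) ≤ scale c n := by
  rw [scale_eq_mul_succ hc n]
  have := scale_pos hc (n + 1)
  have h : (2 : ℝ) ≤ c n := by exact_mod_cast hc n
  gcongr

lemma scale_antitone (hc : ∀ n, 2 ≤ c n) : Antitone (scale c) :=
  antitone_nat_of_succ_le fun n => by
    linarith [two_mul_scale_succ_le hc n, scale_pos hc (n + 1)]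

lemma scale_le_half_pow (hc : ∀ n, 2 ≤ c n) (n : ℕ) : scale c n ≤ (1 / 2) ^ n := by
  induction n with
  | zero => simp [scale]
  | succ n ih => rw [pow_succ]; linarith [two_mul_scale_succ_le hc n]

lemma scale_mul_le_scale_add {M : ℕ} (hc : ∀ n, 2 ≤ c n) (hM : ∀ n, c n ≤ M) (n m : ℕ) :
    ((M : ℝ)⁻¹) ^ m * scale c n ≤ scale c (n + m) := by
  induction m with
  | zero => simp
  | succ m ih =>
    have hM0 : (0 : ℝ) < M := by
      have := (hc 0).trans (hM 0)
      positivity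
    have h := scale_eq_mul_succ hc (n + m)
    have h1 : (c (n + m) : ℝ) ≤ M := by exact_mod_cast hM _
    have h2 : scale c (n + m) ≤ M * scale c (n + m + 1) := by
      rw [h]
      have := scale_pos hc (n + m + 1)
      gcongr
    rw [pow_succ, ← add_assoc]
    calc (M : ℝ)⁻¹ ^ m * (M : ℝ)⁻¹ * scale c n = (M : ℝ)⁻¹ * ((M : ℝ)⁻¹ ^ m * scale c n) := by ring
      _ ≤ (M : ℝ)⁻¹ * (M * scale c (n + m + 1)) :=
        mul_le_mul_of_nonneg_left (ih.trans h2) (by positivity)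
      _ = scale c (n + m + 1) := by field_simp

lemma prefixSum_succ (x : ∀ n, Fin (c n)) (n : ℕ) :
    prefixSum x (n + 1) = prefixSum x n + (x n).val * scale c (n + 1) :=
  Finset.sum_range_succ _ _

lemma prefixSum_eq_prefixIndex_mul (hc : ∀ n, 2 ≤ c n) (x : ∀ n, Fin (c n)) (n : ℕ) :
    prefixSum x n = prefixIndex x n * scale c n := by
  induction n with
  | zero => simp [prefixSum, prefixIndex]
  | succ n ih =>
    rw [prefixSum_succ, ih, scale_eq_mul_succ hc n, prefixIndex]
    push_cast
    ring

lemma digits_eq_of_prefixIndex_eq {x y : ∀ n, Fin (c n)} {n : ℕ}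
    (h : prefixIndex x n = prefixIndex y n) : ∀ i < n, x i = y i := by
  induction n with
  | zero => simp
  | succ n ih =>
    simp only [prefixIndex] at h
    have hpos : 0 < c n := (x n).pos
    have hdiv := congrArg (· / c n) h
    have hmod := congrArg (· % c n) h
    simp only [Nat.mul_add_div hpos, Nat.div_eq_of_lt (x n).2, Nat.div_eq_of_lt (y n).2,
      add_zero] at hdiv
    simp only [Nat.mul_add_mod, Nat.mod_eq_of_lt (x n).2, Nat.mod_eq_of_lt (y n).2] at hmod
    intro i hi
    rcases Nat.lt_succ_iff_lt_or_eq.1 hi with h1 | rfl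
    · exact ih hdiv i h1
    · exact Fin.ext hmod

lemma prefixSum_monotone (hc : ∀ n, 2 ≤ c n) (x : ∀ n, Fin (c n)) : Monotone (prefixSum x) :=
  monotone_nat_of_le_succ fun n => by
    rw [prefixSum_succ]
    have := scale_pos hc (n + 1)
    have : 0 ≤ ((x n).val : ℝ) * scale c (n + 1) := by positivity
    linarith

lemma prefixSum_add_scale_antitone (hc : ∀ n, 2 ≤ c n) (x : ∀ n, Fin (c n)) :
    Antitone fun n => prefixSum x n + scale c n :=
  antitone_nat_of_succ_le fun n => by
    have h : ((x n).val : ℝ) + 1 ≤ c n := by exact_mod_cast (x n).2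
    have := mul_le_mul_of_nonneg_right h (scale_pos hc (n + 1)).le
    rw [prefixSum_succ, scale_eq_mul_succ hc n]
    linarith

lemma tendsto_prefixSum (hc : ∀ n, 2 ≤ c n) (x : ∀ n, Fin (c n)) :
    Tendsto (prefixSum x) atTop (𝓝 (expansion x)) := by
  refine (summable_of_sum_range_le (c := 1) (fun n => ?_) fun n => ?_).hasSum.tendsto_sum_nat
  · have := scale_pos hc (n + 1)
    positivity
  · have h := prefixSum_add_scale_antitone hc x n.zero_le
    simp only [prefixSum, scale, Finset.range_zero, Finset.sum_empty, Finset.prod_empty,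
      zero_add] at h
    have := scale_pos hc n
    simp only [scale] at this ⊢
    linarith

lemma prefixSum_le_expansion (hc : ∀ n, 2 ≤ c n) (x : ∀ n, Fin (c n)) (n : ℕ) :
    prefixSum x n ≤ expansion x :=
  (prefixSum_monotone hc x).ge_of_tendsto (tendsto_prefixSum hc x) n

lemma expansion_le_prefixSum_add_scale (hc : ∀ n, 2 ≤ c n) (x : ∀ n, Fin (c n)) (n : ℕ) :
    expansion x ≤ prefixSum x n + scale c n := by
  refine le_of_tendsto (tendsto_prefixSum hc x) ?_
  filter_upwards [eventually_ge_atTop n] with k hk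
  have := prefixSum_add_scale_antitone hc x hk
  have := scale_pos hc k
  simp only at *
  linarith

lemma prefixSum_congr {x y : ∀ n, Fin (c n)} {n : ℕ} (h : ∀ i < n, x i = y i) :
    prefixSum x n = prefixSum y n :=
  Finset.sum_congr rfl fun i hi => by rw [h i (Finset.mem_range.1 hi)]

lemma abs_expansion_sub_le (hc : ∀ n, 2 ≤ c n) {x y : ∀ n, Fin (c n)} {n : ℕ}
    (h : ∀ i < n, x i = y i) : |expansion x - expansion y| ≤ scale c n := by
  have := prefixSum_congr h
  have := prefixSum_le_expansion hc x n
  have := prefixSum_le_expansion hc y n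
  have := expansion_le_prefixSum_add_scale hc x n
  have := expansion_le_prefixSum_add_scale hc y n
  rw [abs_le]
  constructor <;> linarith

lemma prefixSum_add_le_expansion_of_inner (hc : ∀ n, 2 ≤ c n) {n m : ℕ} {x : ∀ n, Fin (c n)}
    (hx : x ∈ innerPoints c n m) : prefixSum x n + scale c (n + m) ≤ expansion x := by
  obtain ⟨i, hni, him, hi⟩ := hx.1
  have h1 : (1 : ℝ) ≤ (x i).val := by exact_mod_cast Nat.one_le_iff_ne_zero.2 hi
  have := mul_le_mul_of_nonneg_right h1 (scale_pos hc (i + 1)).le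
  have := prefixSum_succ x i
  have := prefixSum_monotone hc x hni
  have := prefixSum_le_expansion hc x (i + 1)
  have := scale_antitone hc (Nat.succ_le_of_lt him)
  simp only [Nat.succ_eq_add_one] at *
  linarith

lemma expansion_add_le_of_inner (hc : ∀ n, 2 ≤ c n) {n m : ℕ} {x : ∀ n, Fin (c n)}
    (hx : x ∈ innerPoints c n m) :
    expansion x + scale c (n + m) ≤ prefixSum x n + scale c n := by
  obtain ⟨i, hni, him, hi⟩ := hx.2
  have h2 : (x i).val + 1 + 1 ≤ c i := lt_of_le_of_ne (x i).2 hi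
  have h1 : ((x i).val : ℝ) + 1 + 1 ≤ c i := by exact_mod_cast h2
  have := mul_le_mul_of_nonneg_right h1 (scale_pos hc (i + 1)).le
  have := prefixSum_succ x i
  have := scale_eq_mul_succ hc i
  have := prefixSum_add_scale_antitone hc x hni
  have := expansion_le_prefixSum_add_scale hc x (i + 1)
  have := scale_antitone hc (Nat.succ_le_of_lt him)
  simp only [Nat.succ_eq_add_one] at *
  linarith

/-- An interior point of the interval of `x` of generation `n` lies in no other interval of
generation `n`. -/
lemma digits_eq_of_mem_interval (hc : ∀ n, 2 ≤ c n) {x y : ∀ n, Fin (c n)} {n : ℕ} {p : ℝ}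
    (hx1 : prefixSum x n < p) (hx2 : p < prefixSum x n + scale c n)
    (hy1 : prefixSum y n ≤ p) (hy2 : p ≤ prefixSum y n + scale c n) : ∀ i < n, x i = y i := by
  apply digits_eq_of_prefixIndex_eq
  have hs := scale_pos hc n
  rw [prefixSum_eq_prefixIndex_mul hc] at *
  have h1 : (prefixIndex x n : ℝ) < prefixIndex y n + 1 := by
    refine lt_of_mul_lt_mul_right ?_ hs.le
    linarith
  have h2 : (prefixIndex y n : ℝ) < prefixIndex x n + 1 := by
    refine lt_of_mul_lt_mul_right ?_ hs.le
    linarith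
  norm_cast at h1 h2
  omega

lemma mem_interval_of_mem_closedBall (hc : ∀ n, 2 ≤ c n) {n m : ℕ} {x : ∀ n, Fin (c n)}
    (hx : x ∈ innerPoints c n m) {p : ℝ}
    (hp : p ∈ closedBall (expansion x) (scale c (n + m + 1))) :
    prefixSum x n < p ∧ p < prefixSum x n + scale c n := by
  have := prefixSum_add_le_expansion_of_inner hc hx
  have := expansion_add_le_of_inner hc hx
  have := two_mul_scale_succ_le hc (n + m)
  have := scale_pos hc (n + m + 1)
  rw [mem_closedBall, Real.dist_eq, abs_le] at hp
  constructor <;> linarith [hp.1, hp.2]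

lemma measurable_expansion (hc : ∀ n, 2 ≤ c n) :
    Measurable (expansion : (∀ n, Fin (c n)) → ℝ) := by
  refine measurable_of_tendsto_metrizable (f := fun n x => prefixSum x n) (fun n => ?_)
    (tendsto_pi_nhds.2 fun x => tendsto_prefixSum hc x)
  exact Finset.measurable_sum _ fun i _ =>
    ((measurable_of_countable fun k : Fin (c i) => (k.val : ℝ)).comp
      (measurable_pi_apply i)).mul_const _

end Expansion

/-! ### Product measures on digit sequences -/

section ProductMeasure

variable {c : ℕ → ℕ}

lemma exists_product_measure (w : ∀ n, Fin (c n) → ℝ) (h0 : ∀ n i, 0 ≤ w n i)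
    (h1 : ∀ n, ∑ i, w n i = 1) :
    ∃ lam : Measure (∀ n, Fin (c n)), IsProbabilityMeasure lam ∧
      ∀ (s : Finset ℕ) (t : ∀ n, Fin (c n)),
        lam {x | ∀ i ∈ s, x i = t i} = ENNReal.ofReal (∏ i ∈ s, w i (t i)) := by
  let m : ∀ n, Measure (Fin (c n)) := fun n =>
    ∑ i, ENNReal.ofReal (w n i) • Measure.dirac i
  have hm : ∀ n, IsProbabilityMeasure (m n) := fun n => ⟨by
    simp only [m, Measure.finsetSum_apply, Measure.smul_apply, measure_univ, smul_eq_mul, mul_one]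
    rw [← ENNReal.ofReal_sum_of_nonneg fun i _ => h0 n i, h1, ENNReal.ofReal_one]⟩
  have hs : ∀ n i, m n {i} = ENNReal.ofReal (w n i) := fun n i => by
    simp only [m, Measure.finsetSum_apply, Measure.smul_apply, smul_eq_mul]
    rw [Finset.sum_eq_single i]
    · simp
    · intro j _ hj
      simp [hj]
    · simp
  refine ⟨Measure.infinitePi m, inferInstance, fun s t => ?_⟩
  have : {x : ∀ n, Fin (c n) | ∀ i ∈ s, x i = t i} = Set.pi s fun i => {t i} := by
    ext x
    simp [Set.mem_pi]
  rw [this, Measure.infinitePi_pi _ fun i _ => measurableSet_singleton _,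
    ENNReal.ofReal_prod_of_nonneg fun i _ => h0 _ _]
  exact Finset.prod_congr rfl fun i _ => hs _ _

lemma measure_compl_innerPoints_le (hc : ∀ n, 2 ≤ c n) {w : ∀ n, Fin (c n) → ℝ}
    (h0 : ∀ n i, 0 ≤ w n i) {ρ : ℝ} (hρ : ∀ n i, w n i ≤ ρ) {lam : Measure (∀ n, Fin (c n))}
    (hlam : ∀ (s : Finset ℕ) (t : ∀ n, Fin (c n)),
      lam {x | ∀ i ∈ s, x i = t i} = ENNReal.ofReal (∏ i ∈ s, w i (t i))) (n m : ℕ) :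
    lam (innerPoints c n m)ᶜ ≤ ENNReal.ofReal (2 * ρ ^ m) := by
  have hpos : ∀ i, 0 < c i := fun i => by have := hc i; omega
  have hρ0 : 0 ≤ ρ := (h0 0 ⟨0, hpos 0⟩).trans (hρ _ _)
  let t0 : ∀ n, Fin (c n) := fun i => ⟨0, hpos i⟩
  let t1 : ∀ n, Fin (c n) := fun i => ⟨c i - 1, Nat.sub_lt (hpos i) one_pos⟩
  have hsub : (innerPoints c n m)ᶜ ⊆
      {x | ∀ i ∈ Finset.Ico n (n + m), x i = t0 i} ∪
        {x | ∀ i ∈ Finset.Ico n (n + m), x i = t1 i} := by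
    intro x hx
    by_contra hcon
    simp only [Set.mem_union, Set.mem_ofPred_eq, not_or, not_forall, Finset.mem_Ico] at hcon
    obtain ⟨⟨i, hi, hi'⟩, j, hj, hj'⟩ := hcon
    refine hx ⟨⟨i, hi.1, hi.2, fun h => hi' (Fin.ext h)⟩, j, hj.1, hj.2, fun h => hj' (Fin.ext ?_)⟩
    simp only [t1]
    omega
  have hle : ∀ t : ∀ n, Fin (c n),
      lam {x | ∀ i ∈ Finset.Ico n (n + m), x i = t i} ≤ ENNReal.ofReal (ρ ^ m) := fun t => by
    rw [hlam]
    refine ENNReal.ofReal_le_ofReal ((Finset.prod_le_prod (fun i _ => h0 _ _)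
      fun i _ => hρ i (t i)).trans_eq ?_)
    simp
  calc lam (innerPoints c n m)ᶜ ≤ ENNReal.ofReal (ρ ^ m) + ENNReal.ofReal (ρ ^ m) :=
        (measure_mono hsub).trans ((measure_union_le _ _).trans (add_le_add (hle t0) (hle t1)))
    _ = ENNReal.ofReal (2 * ρ ^ m) := by
        rw [← ENNReal.ofReal_add (by positivity) (by positivity), two_mul]

lemma mul_rpow_le_rpow {L x y s : ℝ} (hL0 : 0 < L) (hL1 : L ≤ 1) (hx : 0 < x) (h1 : L * x ≤ y)
    (h2 : y ≤ x) : L ^ |s| * x ^ s ≤ y ^ s := by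
  have hy : 0 < y := lt_of_lt_of_le (by positivity) h1
  rcases le_total 0 s with hs | hs
  · rw [abs_of_nonneg hs, ← Real.mul_rpow hL0.le hx.le]
    exact Real.rpow_le_rpow (by positivity) h1 hs
  · calc L ^ |s| * x ^ s ≤ 1 * x ^ s := by
          gcongr
          exact Real.rpow_le_one hL0.le hL1 (abs_nonneg s)
      _ ≤ y ^ s := by
          rw [one_mul]
          exact Real.rpow_le_rpow_of_nonpos hy h2 hs

lemma rpow_mem_bounds {κ x s : ℝ} (hκ : 0 < κ) (h1 : κ ≤ x) (h2 : x ≤ 1) :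
    κ ^ |s| ≤ x ^ s ∧ x ^ s ≤ (κ ^ |s|)⁻¹ := by
  have hκ1 := h1.trans h2
  have hx := hκ.trans_le h1
  have key : ∀ u : ℝ, κ ^ |u| ≤ x ^ u := fun u => by
    simpa using mul_rpow_le_rpow (s := u) hκ hκ1 one_pos (by simpa using h1) h2
  refine ⟨key s, ?_⟩
  have := key (-s)
  rw [abs_neg, Real.rpow_neg hx.le] at this
  exact le_inv_of_le_inv₀ (by positivity) this

/-- The `q`-th power sum `∑_j p_j^q` of the weights at position `n`. -/
def powSum (p : ∀ n, Fin (c n) → ℝ) (q : ℝ) (n : ℕ) : ℝ := ∑ i, p n i ^ q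

lemma powSum_pos (hc : ∀ n, 2 ≤ c n) {p : ∀ n, Fin (c n) → ℝ} (hp : ∀ n i, 0 < p n i) (q : ℝ)
    (n : ℕ) : 0 < powSum p q n :=
  Finset.sum_pos (fun i _ => Real.rpow_pos_of_pos (hp n i) q)
    ⟨⟨0, by have := hc n; omega⟩, Finset.mem_univ _⟩

lemma rpow_abs_le_powSum (hc : ∀ n, 2 ≤ c n) {p : ∀ n, Fin (c n) → ℝ} {κ : ℝ} (hκ : 0 < κ)
    (hp : ∀ n i, κ ≤ p n i) (hp1 : ∀ n i, p n i ≤ 1) (q : ℝ) (n : ℕ) :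
    κ ^ |q| ≤ powSum p q n :=
  (rpow_mem_bounds hκ (hp n ⟨0, by have := hc n; omega⟩) (hp1 _ _)).1.trans
    (Finset.single_le_sum (fun i _ => (Real.rpow_pos_of_pos (hκ.trans_le (hp n i)) q).le)
      (Finset.mem_univ _))

lemma tilted_weight_le {M : ℕ} (hc : ∀ n, 2 ≤ c n) (hM : ∀ n, c n ≤ M)
    {p : ∀ n, Fin (c n) → ℝ} {κ : ℝ} (hκ : 0 < κ)
    (hp : ∀ n i, κ ≤ p n i) (hp1 : ∀ n i, p n i ≤ 1) (q : ℝ) (n : ℕ) (i : Fin (c n)) :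
    p n i ^ q / powSum p q n ≤ 1 - κ ^ |q| / (M * (κ ^ |q|)⁻¹) := by
  have hS := powSum_pos hc (fun n i => hκ.trans_le (hp n i)) q n
  obtain ⟨j, hj⟩ : ∃ j : Fin (c n), j ≠ i := by
    by_cases h : i.val = 0
    · exact ⟨⟨1, hc n⟩, fun h' => by simp [← h'] at h⟩
    · exact ⟨⟨0, by have := hc n; omega⟩, fun h' => by simp [← h'] at h⟩
  have hsum : p n i ^ q + p n j ^ q ≤ powSum p q n := by
    rw [← Finset.sum_pair (f := fun k => p n k ^ q) hj.symm]
    exact Finset.sum_le_sum_of_subset_of_nonneg (Finset.subset_univ _)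
      fun k _ _ => (Real.rpow_pos_of_pos (hκ.trans_le (hp n k)) q).le
  have hSle : powSum p q n ≤ M * (κ ^ |q|)⁻¹ := by
    have hcM : (c n : ℝ) ≤ M := by exact_mod_cast hM n
    calc powSum p q n ≤ ∑ _ : Fin (c n), (κ ^ |q|)⁻¹ :=
          Finset.sum_le_sum fun k _ => (rpow_mem_bounds hκ (hp n k) (hp1 n k)).2
      _ = c n * (κ ^ |q|)⁻¹ := by simp
      _ ≤ M * (κ ^ |q|)⁻¹ := by gcongr
  have h1 : κ ^ |q| / (M * (κ ^ |q|)⁻¹) ≤ p n j ^ q / powSum p q n :=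
    div_le_div₀ (Real.rpow_pos_of_pos (hκ.trans_le (hp n j)) q).le
      (rpow_mem_bounds hκ (hp n j) (hp1 n j)).1 hS hSle
  have h2 : p n i ^ q / powSum p q n + p n j ^ q / powSum p q n ≤ 1 := by
    rw [← add_div, div_le_one hS]
    exact hsum
  linarith

lemma sum_words_prod_rpow {p : ∀ n, Fin (c n) → ℝ} (hp : ∀ n i, 0 < p n i) (q : ℝ) (n : ℕ) :
    ∑ z : (∀ i : Fin n, Fin (c i)), (∏ i : Fin n, p i (z i)) ^ q =
      ∏ i ∈ Finset.range n, powSum p q i := by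
  rw [← Fin.prod_univ_eq_prod_range (fun i => powSum p q i)]
  simp only [powSum]
  rw [Finset.prod_univ_sum, Fintype.piFinset_univ]
  exact Finset.sum_congr rfl fun z _ =>
    (Real.finsetProd_rpow _ _ (fun i _ => (hp _ _).le) q).symm

end ProductMeasure

/-! ### Packing measures of images of product measures -/

section Packing

variable {c : ℕ → ℕ} {M : ℕ} {p : ∀ n, Fin (c n) → ℝ} {κ : ℝ} {μ : Measure (∀ n, Fin (c n))}

lemma pow_le_prod_range {f : ℕ → ℝ} (hκ : 0 ≤ κ) (hf : ∀ i, κ ≤ f i) (n : ℕ) :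
    κ ^ n ≤ ∏ i ∈ Finset.range n, f i := by
  calc κ ^ n = ∏ _i ∈ Finset.range n, κ := by simp
    _ ≤ _ := Finset.prod_le_prod (fun _ _ => hκ) fun i _ => hf i

lemma map_closedBall_bounds (hc : ∀ n, 2 ≤ c n) (hκ : 0 < κ) (hp : ∀ n i, κ ≤ p n i)
    (hμ : ∀ (x : ∀ n, Fin (c n)) n,
      μ {y | ∀ i < n, y i = x i} = ENNReal.ofReal (∏ i ∈ Finset.range n, p i (x i)))
    {n m : ℕ} {x : ∀ n, Fin (c n)} (hx : x ∈ innerPoints c n m) :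
    ENNReal.ofReal (κ ^ (m + 1) * ∏ i ∈ Finset.range n, p i (x i)) ≤
        μ.map expansion (closedBall (expansion x) (scale c (n + m + 1))) ∧
      μ.map expansion (closedBall (expansion x) (scale c (n + m + 1))) ≤
        ENNReal.ofReal (∏ i ∈ Finset.range n, p i (x i)) := by
  rw [Measure.map_apply (measurable_expansion hc) measurableSet_closedBall]
  constructor
  · refine le_trans (ENNReal.ofReal_le_ofReal ?_) ((hμ x (n + m + 1)).symm.trans_le
      (measure_mono fun y hy => ?_))
    · rw [add_assoc, Finset.prod_range_add, mul_comm]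
      exact mul_le_mul_of_nonneg_left (pow_le_prod_range hκ.le (fun i => hp _ _) _)
        (Finset.prod_nonneg fun i _ => hκ.le.trans (hp _ _))
    · rw [Set.mem_preimage, mem_closedBall, Real.dist_eq]
      exact abs_expansion_sub_le hc hy
  · rw [← hμ x n]
    refine measure_mono fun y hy i hi => ?_
    obtain ⟨h1, h2⟩ := mem_interval_of_mem_closedBall hc hx hy
    exact (digits_eq_of_mem_interval hc h1 h2 (prefixSum_le_expansion hc y n)
      (expansion_le_prefixSum_add_scale hc y n) i hi).symm

lemma le_olsen_term (hc : ∀ n, 2 ≤ c n) (hM : ∀ n, c n ≤ M) (hκ : 0 < κ)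
    (hp : ∀ n i, κ ≤ p n i) (hp1 : ∀ n i, p n i ≤ 1)
    (hμ : ∀ (x : ∀ n, Fin (c n)) n,
      μ {y | ∀ i < n, y i = x i} = ENNReal.ofReal (∏ i ∈ Finset.range n, p i (x i)))
    (q t : ℝ) {n m : ℕ} {x : ∀ n, Fin (c n)} (hx : x ∈ innerPoints c n m) :
    ENNReal.ofReal ((κ ^ (m + 1)) ^ |q| * ((M : ℝ)⁻¹ ^ (m + 1)) ^ |t| *
        ((∏ i ∈ Finset.range n, p i (x i)) ^ q * scale c n ^ t)) ≤
      μ.map expansion (closedBall (expansion x) (scale c (n + m + 1))) ^ q *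
        ENNReal.ofReal (2 * scale c (n + m + 1)) ^ t := by
  obtain ⟨hl, hu⟩ := map_closedBall_bounds hc hκ hp hμ hx
  set P := ∏ i ∈ Finset.range n, p i (x i)
  set b := μ.map expansion (closedBall (expansion x) (scale c (n + m + 1)))
  have hP : 0 < P := Finset.prod_pos fun i _ => hκ.trans_le (hp _ _)
  have hb : b ≠ ⊤ := ne_top_of_le_ne_top ENNReal.ofReal_ne_top hu
  have hl' : κ ^ (m + 1) * P ≤ b.toReal := (ENNReal.ofReal_le_iff_le_toReal hb).1 hl
  have hu' : b.toReal ≤ P := ENNReal.toReal_le_of_le_ofReal hP.le hu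
  have hb0 : 0 < b.toReal := lt_of_lt_of_le (by positivity) hl'
  have hκ1 : κ ≤ 1 := (hp 0 (x 0)).trans (hp1 0 (x 0))
  have hM1 : (1 : ℝ) ≤ M := by exact_mod_cast one_le_two.trans ((hc 0).trans (hM 0))
  have hs := scale_pos hc n
  have hs' := scale_pos hc (n + m + 1)
  have h1 : (κ ^ (m + 1)) ^ |q| * P ^ q ≤ b.toReal ^ q :=
    mul_rpow_le_rpow (by positivity) (pow_le_one₀ hκ.le hκ1) hP hl' hu'
  have h2 : ((M : ℝ)⁻¹ ^ (m + 1)) ^ |t| * scale c n ^ t ≤ (2 * scale c (n + m + 1)) ^ t := by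
    refine mul_rpow_le_rpow (by positivity)
      (pow_le_one₀ (by positivity) (inv_le_one_of_one_le₀ hM1)) hs ?_ ?_
    · have := scale_mul_le_scale_add hc hM n (m + 1)
      rw [← add_assoc] at this
      linarith
    · exact (two_mul_scale_succ_le hc (n + m)).trans (scale_antitone hc (Nat.le_add_right n m))
  rw [← ENNReal.ofReal_toReal hb, ENNReal.ofReal_rpow_of_pos hb0,
    ENNReal.ofReal_rpow_of_pos (by positivity), ← ENNReal.ofReal_mul (by positivity)]
  refine ENNReal.ofReal_le_ofReal ?_
  calc _ = ((κ ^ (m + 1)) ^ |q| * P ^ q) * (((M : ℝ)⁻¹ ^ (m + 1)) ^ |t| * scale c n ^ t) := by ring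
    _ ≤ _ := mul_le_mul h1 h2 (by positivity) (by positivity)

lemma mul_measure_le_Pdel (hc : ∀ n, 2 ≤ c n) (hM : ∀ n, c n ≤ M) (hκ : 0 < κ)
    (hp : ∀ n i, κ ≤ p n i) (hp1 : ∀ n i, p n i ≤ 1)
    (hμ : ∀ (x : ∀ n, Fin (c n)) n,
      μ {y | ∀ i < n, y i = x i} = ENNReal.ofReal (∏ i ∈ Finset.range n, p i (x i)))
    (q t : ℝ) {lam : Measure (∀ n, Fin (c n))}
    (hlam : ∀ (s : Finset ℕ) (x : ∀ n, Fin (c n)), lam {y | ∀ i ∈ s, y i = x i} =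
      ENNReal.ofReal (∏ i ∈ s, p i (x i) ^ q / powSum p q i))
    {n m : ℕ} {δ K : ℝ} (hδ : scale c (n + m + 1) ≤ δ) (hK0 : 0 ≤ K)
    (hK : K ≤ (∏ i ∈ Finset.range n, powSum p q i) * scale c n ^ t) (E : Set ℝ) :
    ENNReal.ofReal K * (ENNReal.ofReal ((κ ^ (m + 1)) ^ |q| * ((M : ℝ)⁻¹ ^ (m + 1)) ^ |t|) *
        lam (expansion ⁻¹' E ∩ innerPoints c n m)) ≤ Pdel (μ.map expansion) q t δ E := by
  set A := (expansion : (∀ n, Fin (c n)) → ℝ) ⁻¹' E ∩ innerPoints c n m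
  set C := (κ ^ (m + 1)) ^ |q| * ((M : ℝ)⁻¹ ^ (m + 1)) ^ |t|
  have hC : 0 ≤ C := by positivity
  let ι : Type := {z : (∀ i : Fin n, Fin (c i)) // (A ∩ prefixCyl z).Nonempty}
  choose x hx using fun z : ι => z.2
  have hcover : A ⊆ ⋃ z : ι, prefixCyl z.1 := fun y hy =>
    Set.mem_iUnion.2 ⟨⟨fun i => y i, y, hy, fun _ => rfl⟩, fun _ => rfl⟩
  have hterm : ∀ z : ι, ENNReal.ofReal K * (ENNReal.ofReal C * lam (prefixCyl z.1)) ≤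
      μ.map expansion (closedBall (expansion (x z)) (scale c (n + m + 1))) ^ q *
        ENNReal.ofReal (2 * scale c (n + m + 1)) ^ t := fun z => by
    have hz : prefixCyl z.1 = {y | ∀ i ∈ Finset.range n, y i = x z i} := by
      ext y
      constructor
      · intro hy i hi
        exact (hy ⟨i, Finset.mem_range.1 hi⟩).trans ((hx z).2 ⟨i, Finset.mem_range.1 hi⟩).symm
      · intro hy i
        exact (hy i (Finset.mem_range.2 i.2)).trans ((hx z).2 i)
    rw [hz, hlam, ← ENNReal.ofReal_mul hC, ← ENNReal.ofReal_mul hK0]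
    refine le_trans (ENNReal.ofReal_le_ofReal ?_)
      (le_olsen_term hc hM hκ hp hp1 hμ q t (hx z).1.2)
    rw [Finset.prod_div_distrib, Real.finsetProd_rpow _ _ fun i _ => hκ.le.trans (hp _ _)]
    have hZ : 0 < ∏ i ∈ Finset.range n, powSum p q i :=
      Finset.prod_pos fun i _ => powSum_pos hc (fun n i => hκ.trans_le (hp n i)) q i
    have hP : 0 < ∏ i ∈ Finset.range n, p i (x z i) :=
      Finset.prod_pos fun i _ => hκ.trans_le (hp _ _)
    set Z := ∏ i ∈ Finset.range n, powSum p q i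
    set P := ∏ i ∈ Finset.range n, p i (x z i)
    calc K * (C * (P ^ q / Z)) ≤ Z * scale c n ^ t * (C * (P ^ q / Z)) :=
          mul_le_mul_of_nonneg_right hK (by positivity)
      _ = C * (P ^ q * scale c n ^ t) := by field_simp
  refine le_trans ?_ (le_iSup_of_le ι <| le_iSup_of_le inferInstance <|
    le_iSup_of_le (fun z => expansion (x z)) <| le_iSup_of_le (fun _ => scale c (n + m + 1)) <|
    le_iSup_of_le (fun z => (hx z).1.1) <| le_iSup_of_le (fun _ => ⟨scale_pos hc _, hδ⟩) <|
    le_iSup_of_le (fun z z' hzz' => ?_) le_rfl)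
  · calc _ ≤ ENNReal.ofReal K * (ENNReal.ofReal C * ∑' z : ι, lam (prefixCyl z.1)) := by
          gcongr
          exact (measure_mono hcover).trans (measure_iUnion_le _)
      _ = ∑' z : ι, ENNReal.ofReal K * (ENNReal.ofReal C * lam (prefixCyl z.1)) := by
          rw [ENNReal.tsum_mul_left, ENNReal.tsum_mul_left]
      _ ≤ _ := ENNReal.tsum_le_tsum hterm
  · refine Set.disjoint_left.2 fun u hu hu' => hzz' (Subtype.ext (funext fun i => ?_))
    obtain ⟨h1, h2⟩ := mem_interval_of_mem_closedBall hc (hx z).1.2 hu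
    obtain ⟨h3, h4⟩ := mem_interval_of_mem_closedBall hc (hx z').1.2 hu'
    rw [← (hx z).2 i, ← (hx z').2 i]
    exact digits_eq_of_mem_interval hc h1 h2 h3.le h4.le i i.2

lemma eq_top_of_forall_ofReal_mul_le {u v : ℝ≥0∞} (hu : u ≠ 0)
    (h : ∀ K : ℝ, 0 ≤ K → ENNReal.ofReal K * u ≤ v) : v = ⊤ := by
  by_contra hv
  have hu' : u ≠ ⊤ := by
    rintro rfl
    exact hv (top_le_iff.1 (by simpa using h 1 zero_le_one))
  have hdiv : v / u ≠ ⊤ := ENNReal.div_ne_top hv hu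
  have h1 := h ((v / u).toReal + 1) (by positivity)
  rw [← ENNReal.le_div_iff_mul_le (Or.inl hu) (Or.inl hu'),
    ENNReal.ofReal_le_iff_le_toReal hdiv] at h1
  linarith

lemma frequently_le_mul_scale_rpow (hc : ∀ n, 2 ≤ c n) {Z : ℕ → ℝ} {s t : ℝ} (hts : t < s)
    (hZ : ∃ᶠ n in atTop, 1 ≤ Z n * scale c n ^ s) (K : ℝ) :
    ∃ᶠ n in atTop, K ≤ Z n * scale c n ^ t := by
  have hgrow : Tendsto (fun n : ℕ => ((2 : ℝ) ^ (s - t)) ^ n) atTop atTop :=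
    tendsto_pow_atTop_atTop_of_one_lt (Real.one_lt_rpow one_lt_two (by linarith))
  refine (hZ.and_eventually (hgrow.eventually_ge_atTop K)).mono fun n ⟨h1, h2⟩ => ?_
  have hs := scale_pos hc n
  have h3 : ((2 : ℝ) ^ (s - t)) ^ n ≤ scale c n ^ (t - s) := by
    calc ((2 : ℝ) ^ (s - t)) ^ n = ((1 / 2 : ℝ) ^ n) ^ (t - s) := by
          rw [← Real.rpow_natCast, ← Real.rpow_natCast, one_div, Real.inv_rpow zero_le_two,
            ← Real.rpow_neg zero_le_two, ← Real.rpow_mul zero_le_two, ← Real.rpow_mul zero_le_two]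
          congr 1
          ring
      _ ≤ scale c n ^ (t - s) :=
          Real.rpow_le_rpow_of_nonpos hs (scale_le_half_pow hc n) (by linarith)
  calc K ≤ scale c n ^ (t - s) := h2.trans h3
    _ ≤ Z n * scale c n ^ s * scale c n ^ (t - s) := le_mul_of_one_le_left (by positivity) h1
    _ = Z n * scale c n ^ t := by
        rw [mul_assoc, ← Real.rpow_add hs]
        congr 2
        ring

/-- The packing measure of index `t` is infinite as soon as some `s > t` satisfies
`∑_{|z| = n} μ([z])^q |z|^s ≥ 1` for infinitely many `n`. -/
theorem Pmeas_map_expansion_eq_top (hc : ∀ n, 2 ≤ c n) (hM : ∀ n, c n ≤ M) (hκ : 0 < κ)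
    (hp : ∀ n i, κ ≤ p n i) (hp1 : ∀ n i, p n i ≤ 1)
    (hμ : ∀ (x : ∀ n, Fin (c n)) n,
      μ {y | ∀ i < n, y i = x i} = ENNReal.ofReal (∏ i ∈ Finset.range n, p i (x i)))
    {q s t : ℝ} (hts : t < s)
    (hs : ∃ᶠ n in atTop, 1 ≤ (∏ i ∈ Finset.range n, powSum p q i) * scale c n ^ s)
    {E : Set ℝ} (hE : Set.range (expansion : (∀ n, Fin (c n)) → ℝ) ⊆ E) :
    Pmeas (μ.map expansion) q t E = ⊤ := by
  have hppos : ∀ n i, 0 < p n i := fun n i => hκ.trans_le (hp n i)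
  have hw0 : ∀ n (i : Fin (c n)), 0 ≤ p n i ^ q / powSum p q n := fun n i =>
    div_nonneg (Real.rpow_pos_of_pos (hppos n i) q).le (powSum_pos hc hppos q n).le
  obtain ⟨lam, _, hlam⟩ := exists_product_measure (fun n i => p n i ^ q / powSum p q n) hw0
    fun n => by rw [← Finset.sum_div]; exact div_self (powSum_pos hc hppos q n).ne'
  simp only [Pmeas, iInf_eq_top]
  intro En hEn
  obtain ⟨k, hk⟩ : ∃ k, lam (expansion ⁻¹' En k) ≠ 0 := by
    by_contra! hcon
    have huniv : (Set.univ : Set (∀ n, Fin (c n))) ⊆ ⋃ k, expansion ⁻¹' En k := fun x _ => by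
      rw [← Set.preimage_iUnion]
      exact hEn (hE ⟨x, rfl⟩)
    have := measure_mono_null huniv (measure_iUnion_null hcon)
    simp at this
  refine ENNReal.tsum_eq_top_of_eq_top ⟨k, ?_⟩
  set β := lam (expansion ⁻¹' En k)
  have hM0 : (0 : ℝ) < M := by
    have := (hc 0).trans (hM 0)
    positivity
  set ρ := 1 - κ ^ |q| / (M * (κ ^ |q|)⁻¹)
  have hρ1 : ρ < 1 := sub_lt_self _ (by positivity)
  have hwρ := tilted_weight_le hc hM hκ hp hp1 q
  have hρ0 : 0 ≤ ρ := (hw0 0 ⟨0, by have := hc 0; omega⟩).trans (hwρ _ _)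
  obtain ⟨m, hm⟩ : ∃ m : ℕ, ENNReal.ofReal (2 * ρ ^ m) < β := by
    have h0 : Tendsto (fun m : ℕ => ENNReal.ofReal (2 * ρ ^ m)) atTop (𝓝 0) := by
      have := ENNReal.tendsto_ofReal
        ((tendsto_pow_atTop_nhds_zero_of_lt_one hρ0 hρ1).const_mul 2)
      simpa using this
    exact (h0.eventually_lt_const (pos_iff_ne_zero.2 hk)).exists
  have hinner : ∀ n, β - ENNReal.ofReal (2 * ρ ^ m) ≤
      lam (expansion ⁻¹' En k ∩ innerPoints c n m) := fun n => by
    rw [tsub_le_iff_right]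
    refine (measure_mono fun x hx => ?_).trans ((measure_union_le _ (innerPoints c n m)ᶜ).trans
      (add_le_add_right (measure_compl_innerPoints_le hc hw0 hwρ hlam n m) _))
    by_cases h : x ∈ innerPoints c n m
    · exact Or.inl ⟨hx, h⟩
    · exact Or.inr h
  simp only [Ppre, iInf_eq_top]
  intro δ hδ
  refine eq_top_of_forall_ofReal_mul_le
    (u := ENNReal.ofReal ((κ ^ (m + 1)) ^ |q| * ((M : ℝ)⁻¹ ^ (m + 1)) ^ |t|) *
      (β - ENNReal.ofReal (2 * ρ ^ m))) ?_ fun K hK => ?_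
  · exact mul_ne_zero (ENNReal.ofReal_pos.2 (by positivity)).ne' (tsub_pos_of_lt hm).ne'
  · have hsmall : Tendsto (scale c) atTop (𝓝 0) :=
      squeeze_zero (fun n => (scale_pos hc n).le) (scale_le_half_pow hc)
        (tendsto_pow_atTop_nhds_zero_of_lt_one (by norm_num) (by norm_num))
    obtain ⟨n, hn1, hn2⟩ := ((frequently_le_mul_scale_rpow hc hts hs K).and_eventually
      (hsmall.eventually_lt_const hδ)).exists
    refine le_trans ?_ (mul_measure_le_Pdel (m := m) hc hM hκ hp hp1 hμ q t hlam
      ((scale_antitone hc (by omega)).trans hn2.le) hK hn1 (En k))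
    gcongr
    exact hinner n

lemma exists_mem_range_of_mem_msupport (hc : ∀ n, 2 ≤ c n) {x r : ℝ}
    (hx : x ∈ msupport (μ.map expansion)) (hr : 0 < r) :
    ∃ y : ∀ n, Fin (c n), |expansion y - x| < r := by
  have h := hx r hr
  rw [Measure.map_apply (measurable_expansion hc) measurableSet_ball] at h
  obtain ⟨y, hy⟩ := nonempty_of_measure_ne_zero h.ne'
  exact ⟨y, by simpa [Real.dist_eq] using hy⟩

lemma cylinder_subset_preimage (hc : ∀ n, 2 ≤ c n) {y : ∀ n, Fin (c n)} {n : ℕ} {x r : ℝ}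
    (h : |expansion y - x| + scale c n < r) :
    {z | ∀ i < n, z i = y i} ⊆ expansion ⁻¹' ball x r := fun z hz => by
  rw [Set.mem_preimage, mem_ball, Real.dist_eq]
  calc |expansion z - x| ≤ |expansion z - expansion y| + |expansion y - x| := abs_sub_le _ _ _
    _ < r := by linarith [abs_expansion_sub_le hc hz]

lemma range_expansion_subset_msupport (hc : ∀ n, 2 ≤ c n) (hp : ∀ n i, 0 < p n i)
    (hμ : ∀ (x : ∀ n, Fin (c n)) n,
      μ {y | ∀ i < n, y i = x i} = ENNReal.ofReal (∏ i ∈ Finset.range n, p i (x i))) :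
    Set.range (expansion : (∀ n, Fin (c n)) → ℝ) ⊆ msupport (μ.map expansion) := by
  rintro _ ⟨y, rfl⟩ r hr
  rw [Measure.map_apply (measurable_expansion hc) measurableSet_ball]
  obtain ⟨n, hn⟩ := exists_pow_lt_of_lt_one hr (one_half_lt_one (α := ℝ))
  refine lt_of_lt_of_le ?_ (measure_mono (cylinder_subset_preimage hc (y := y) (n := n) ?_))
  · rw [hμ]
    exact ENNReal.ofReal_pos.2 (Finset.prod_pos fun i _ => hp _ _)
  · simpa using (scale_le_half_pow hc n).trans_lt hn

lemma ofReal_rpow_le_map_closedBall (hc : ∀ n, 2 ≤ c n) (hκ : 0 < κ) (hκ1 : κ ≤ 1)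
    (hp : ∀ n i, κ ≤ p n i)
    (hμ : ∀ (x : ∀ n, Fin (c n)) n,
      μ {y | ∀ i < n, y i = x i} = ENNReal.ofReal (∏ i ∈ Finset.range n, p i (x i)))
    {x r : ℝ} (hx : x ∈ msupport (μ.map expansion)) (hr : 0 < r) (hr1 : r ≤ 1) :
    ENNReal.ofReal ((r / 4) ^ Real.logb (1 / 2) κ) ≤ μ.map expansion (closedBall x r) := by
  rw [Measure.map_apply (measurable_expansion hc) measurableSet_closedBall]
  obtain ⟨y, hy⟩ := exists_mem_range_of_mem_msupport hc hx (half_pos hr)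
  obtain ⟨n, hn1, hn2⟩ := exists_nat_pow_near_of_lt_one (half_pos hr) (by linarith)
    (one_half_pos (α := ℝ)) one_half_lt_one
  have hsub := cylinder_subset_preimage hc (y := y) (n := n + 1) (x := x) (r := r)
    (by linarith [scale_le_half_pow hc (n + 1)])
  refine le_trans (ENNReal.ofReal_le_ofReal ?_) ((hμ y (n + 1)).symm.trans_le
    (measure_mono (hsub.trans (Set.preimage_mono ball_subset_closedBall))))
  refine le_trans ?_ (pow_le_prod_range hκ.le (fun i => hp _ _) (n + 1))
  have hs : 0 ≤ Real.logb (1 / 2) κ :=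
    Real.logb_nonneg_of_base_lt_one (by norm_num) (by norm_num) hκ hκ1
  calc (r / 4) ^ Real.logb (1 / 2) κ ≤ ((1 / 2 : ℝ) ^ (n + 1)) ^ Real.logb (1 / 2) κ := by
        refine Real.rpow_le_rpow (by positivity) ?_ hs
        rw [pow_succ]
        linarith
    _ = κ ^ (n + 1) := by
        rw [← Real.rpow_natCast, ← Real.rpow_mul (by norm_num), mul_comm,
          Real.rpow_mul (by norm_num), Real.rpow_logb (by norm_num) (by norm_num) hκ,
          Real.rpow_natCast]

lemma Pmeas_eq_zero_of_Ppre_eq_zero {m : Measure ℝ} {q t : ℝ} {E : Set ℝ}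
    (h : Ppre m q t E = 0) : Pmeas m q t E = 0 :=
  le_antisymm (iInf_le_of_le (fun _ => E) (iInf_le_of_le
    (Set.subset_iUnion (fun _ : ℕ => E) 0) (by simp [h]))) zero_le

theorem exists_Pmeas_msupport_eq_zero [IsProbabilityMeasure μ] (hc : ∀ n, 2 ≤ c n) (hκ : 0 < κ)
    (hκ1 : κ ≤ 1) (hp : ∀ n i, κ ≤ p n i)
    (hμ : ∀ (x : ∀ n, Fin (c n)) n,
      μ {y | ∀ i < n, y i = x i} = ENNReal.ofReal (∏ i ∈ Finset.range n, p i (x i))) (q : ℝ) :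
    ∃ t, Pmeas (μ.map expansion) q t (msupport (μ.map expansion)) = 0 := by
  have := Measure.isProbabilityMeasure_map (μ := μ) (measurable_expansion hc).aemeasurable
  set ν := μ.map expansion
  set s := Real.logb (1 / 2) κ
  have hs : 0 ≤ s := Real.logb_nonneg_of_base_lt_one (by norm_num) (by norm_num) hκ hκ1
  refine ⟨s * |q| + 2, Pmeas_eq_zero_of_Ppre_eq_zero ?_⟩
  have hterm : ∀ x ∈ msupport ν, ∀ r δ : ℝ, 0 < r → r ≤ δ → δ ≤ 1 →
      ν (closedBall x r) ^ q * ENNReal.ofReal (2 * r) ^ (s * |q| + 2) ≤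
        ENNReal.ofReal (8 ^ (s * |q|) * (2 * δ)) * volume (closedBall x r) := by
    intro x hx r δ hr hrδ hδ
    have hl := ofReal_rpow_le_map_closedBall hc hκ hκ1 hp hμ hx hr (hrδ.trans hδ)
    have hb : ν (closedBall x r) ≠ ⊤ := measure_ne_top _ _
    rw [ENNReal.ofReal_le_iff_le_toReal hb] at hl
    have hpos : 0 < (r / 4) ^ s := by positivity
    have hb1 : (ν (closedBall x r)).toReal ≤ 1 := measureReal_le_one
    have hu := (rpow_mem_bounds (s := q) hpos hl hb1).2
    have hδ0 := hr.trans_le hrδ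
    rw [Real.volume_closedBall, ← ENNReal.ofReal_toReal hb,
      ENNReal.ofReal_rpow_of_pos (hpos.trans_le hl), ENNReal.ofReal_rpow_of_pos (by positivity),
      ← ENNReal.ofReal_mul (by positivity), ← ENNReal.ofReal_mul (by positivity)]
    refine ENNReal.ofReal_le_ofReal ?_
    calc _ ≤ (((r / 4) ^ s) ^ |q|)⁻¹ * (2 * r) ^ (s * |q| + 2) := by gcongr
      _ = 8 ^ (s * |q|) * ((2 * r) * (2 * r)) := by
          rw [← Real.rpow_mul (by positivity), Real.rpow_add (by positivity),
            show (2 * r : ℝ) = 8 * (r / 4) by ring, Real.mul_rpow (by norm_num) (by positivity),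
            Real.rpow_two]
          field_simp
      _ ≤ 8 ^ (s * |q|) * (2 * δ) * (2 * r) := by
          rw [mul_assoc (8 ^ (s * |q|))]
          gcongr
  have hPdel : ∀ δ : ℝ, 0 < δ → δ ≤ 1 → Pdel ν q (s * |q| + 2) δ (msupport ν) ≤
      ENNReal.ofReal (8 ^ (s * |q|) * (2 * δ)) * ENNReal.ofReal 5 := by
    intro δ hδ0 hδ
    refine iSup_le fun ι => iSup_le fun _ => iSup_le fun x => iSup_le fun r =>
      iSup_le fun hx => iSup_le fun hr => iSup_le fun hdisj => ?_
    calc _ ≤ ∑' i, ENNReal.ofReal (8 ^ (s * |q|) * (2 * δ)) * volume (closedBall (x i) (r i)) :=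
          ENNReal.tsum_le_tsum fun i => hterm _ (hx i) _ _ (hr i).1 (hr i).2 hδ
      _ = ENNReal.ofReal (8 ^ (s * |q|) * (2 * δ)) * volume (⋃ i, closedBall (x i) (r i)) := by
          rw [ENNReal.tsum_mul_left, measure_iUnion (fun i j hij => hdisj i j hij)
            fun i => measurableSet_closedBall]
      _ ≤ ENNReal.ofReal (8 ^ (s * |q|) * (2 * δ)) * volume (Set.Icc (-2 : ℝ) 3) := by
          gcongr
          refine Set.iUnion_subset fun i u hu => ?_
          obtain ⟨y, hy⟩ := exists_mem_range_of_mem_msupport hc (hx i) one_pos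
          have h0 := prefixSum_le_expansion hc y 0
          have h1 := expansion_le_prefixSum_add_scale hc y 0
          simp only [prefixSum, scale, Finset.range_zero, Finset.sum_empty,
            Finset.prod_empty] at h0 h1
          rw [mem_closedBall, Real.dist_eq, abs_le] at hu
          rw [abs_lt] at hy
          have := (hr i).2
          constructor <;> linarith [hu.1, hu.2, hy.1, hy.2]
      _ = _ := by rw [Real.volume_Icc]; norm_num
  have hlim : Tendsto (fun δ : ℝ => ENNReal.ofReal (8 ^ (s * |q|) * (2 * δ)) * ENNReal.ofReal 5)
      (𝓝[>] 0) (𝓝 0) := by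
    simp_rw [← ENNReal.ofReal_mul' (show (0 : ℝ) ≤ 5 by norm_num)]
    have : Tendsto (fun δ : ℝ => 8 ^ (s * |q|) * (2 * δ) * 5) (𝓝[>] 0)
        (𝓝 (8 ^ (s * |q|) * (2 * 0) * 5)) :=
      ((by fun_prop : Continuous fun δ : ℝ => 8 ^ (s * |q|) * (2 * δ) * 5).tendsto 0).mono_left
        nhdsWithin_le_nhds
    simpa using ENNReal.tendsto_ofReal this
  refine le_antisymm (ge_of_tendsto hlim ?_) zero_le
  filter_upwards [Ioc_mem_nhdsGT (show (0 : ℝ) < 1 from one_pos)] with δ hδ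
  exact (iInf₂_le δ hδ.1).trans (hPdel δ hδ.1 hδ.2)

end Packing

/-! ### Inhomogeneous multinomial measures as product measures -/

section Multinomial

variable {c₁ c₂ : ℕ} {T : ℕ → ℕ} {a b : ℕ → ℝ}

/-- The weight of the digit `i` at position `n` for the inhomogeneous multinomial measure. -/
def digitWeight (c₁ c₂ : ℕ) (T : ℕ → ℕ) (a b : ℕ → ℝ) (n : ℕ) (i : Fin (Yc c₁ c₂ T n)) : ℝ :=
  if isA T (n + 1) then a i.val else b i.val

lemma two_le_Yc (hc₁ : 2 ≤ c₁) (hc₂ : 2 ≤ c₂) (n : ℕ) : 2 ≤ Yc c₁ c₂ T n := by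
  unfold Yc
  split_ifs <;> assumption

lemma Yc_le_max (n : ℕ) : Yc c₁ c₂ T n ≤ max c₁ c₂ := by
  unfold Yc
  split_ifs <;> simp

lemma Ncount_le (n : ℕ) : Ncount T n ≤ n :=
  (Finset.card_filter_le _ _).trans (by simp)

lemma Ncount_succ (n : ℕ) : Ncount T (n + 1) = Ncount T n + if isA T (n + 1) then 1 else 0 := by
  unfold Ncount
  rw [← Finset.insert_Icc_right_eq_Icc_add_one (by omega), Finset.filter_insert]
  split_ifs
  · rw [Finset.card_insert_of_notMem (by simp)]
  · simp

lemma Dw_eq_scale (n : ℕ) : Dw c₁ c₂ T n = scale (Yc c₁ c₂ T) n := by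
  induction n with
  | zero => simp [Dw, scale, Ncount]
  | succ n ih =>
    have hN := Ncount_le (T := T) n
    have : scale (Yc c₁ c₂ T) (n + 1) = scale (Yc c₁ c₂ T) n * (Yc c₁ c₂ T n : ℝ)⁻¹ :=
      Finset.prod_range_succ _ _
    rw [this, ← ih, Dw, Dw, Ncount_succ, Yc]
    split_ifs
    · rw [Nat.add_sub_add_right, pow_succ, ← mul_inv]
      ring
    · rw [add_zero, Nat.sub_add_comm hN, pow_succ, ← mul_inv]
      ring

lemma gammaMap_eq_expansion : gammaMap c₁ c₂ T = expansion := by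
  funext x
  simp only [gammaMap, expansion, Dw_eq_scale]

lemma digitWeight_mem_Ioo (ha : ∀ i, i < c₁ → 0 < a i ∧ a i < 1)
    (hb : ∀ j, j < c₂ → 0 < b j ∧ b j < 1) (n : ℕ) (i : Fin (Yc c₁ c₂ T n)) :
    0 < digitWeight c₁ c₂ T a b n i ∧ digitWeight c₁ c₂ T a b n i < 1 := by
  have hi := i.2
  unfold Yc at hi
  unfold digitWeight
  split_ifs at hi ⊢
  · exact ha _ hi
  · exact hb _ hi

lemma exists_lower_bound_of_pos (f : ℕ → ℝ) (n : ℕ) (hf : ∀ i < n, 0 < f i) :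
    ∃ κ, 0 < κ ∧ ∀ i < n, κ ≤ f i := by
  induction n with
  | zero => exact ⟨1, one_pos, by simp⟩
  | succ n ih =>
    obtain ⟨κ, hκ, h⟩ := ih fun i hi => hf i (by omega)
    refine ⟨min κ (f n), lt_min hκ (hf n (by omega)), fun i hi => ?_⟩
    rcases Nat.lt_succ_iff_lt_or_eq.1 hi with hi' | rfl
    · exact (min_le_left _ _).trans (h i hi')
    · exact min_le_right _ _

lemma exists_le_digitWeight (T : ℕ → ℕ) (ha : ∀ i, i < c₁ → 0 < a i ∧ a i < 1)
    (hb : ∀ j, j < c₂ → 0 < b j ∧ b j < 1) :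
    ∃ κ, 0 < κ ∧ ∀ n i, κ ≤ digitWeight c₁ c₂ T a b n i := by
  obtain ⟨κ₁, h₁, hκ₁⟩ := exists_lower_bound_of_pos a c₁ fun i hi => (ha i hi).1
  obtain ⟨κ₂, h₂, hκ₂⟩ := exists_lower_bound_of_pos b c₂ fun i hi => (hb i hi).1
  refine ⟨min κ₁ κ₂, lt_min h₁ h₂, fun n i => ?_⟩
  have hi := i.2
  unfold Yc at hi
  unfold digitWeight
  split_ifs at hi ⊢
  · exact (min_le_left _ _).trans (hκ₁ _ hi)
  · exact (min_le_right _ _).trans (hκ₂ _ hi)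

lemma tauN_eq (hp : ∀ n i, 0 < digitWeight c₁ c₂ T a b n i) (q : ℝ) (n : ℕ) :
    tauN c₁ c₂ T a b q n =
      Real.log (∏ i ∈ Finset.range n, powSum (digitWeight c₁ c₂ T a b) q i) /
        Real.log (scale (Yc c₁ c₂ T) n)⁻¹ := by
  rw [← sum_words_prod_rpow hp, ← Dw_eq_scale, Dw, inv_inv]
  rfl

lemma mul_log_two_le_log_scale_inv {c : ℕ → ℕ} (hc : ∀ n, 2 ≤ c n) (n : ℕ) :
    n * Real.log 2 ≤ Real.log (scale c n)⁻¹ := by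
  rw [← Real.log_pow]
  refine Real.log_le_log (by positivity) ?_
  have h := scale_le_half_pow hc n
  rw [one_div, inv_pow] at h
  exact le_inv_of_le_inv₀ (scale_pos hc n) h

lemma isBoundedUnder_ge_tauN (hc₁ : 2 ≤ c₁) (hc₂ : 2 ≤ c₂)
    (ha : ∀ i, i < c₁ → 0 < a i ∧ a i < 1) (hb : ∀ j, j < c₂ → 0 < b j ∧ b j < 1) (q : ℝ) :
    atTop.IsBoundedUnder (· ≥ ·) (tauN c₁ c₂ T a b q) := by
  obtain ⟨κ, hκ, hp⟩ := exists_le_digitWeight T ha hb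
  have hp1 := fun n i => (digitWeight_mem_Ioo (T := T) ha hb n i).2.le
  have hc := two_le_Yc (T := T) hc₁ hc₂
  have hlog2 : 0 < Real.log 2 := Real.log_pos one_lt_two
  have hκ1 : κ ≤ 1 := (hp 0 ⟨0, by have := hc 0; omega⟩).trans (hp1 _ _)
  set C := -(|q| * Real.log κ) / Real.log 2
  have hC : 0 ≤ C := div_nonneg (neg_nonneg.2
    (mul_nonpos_of_nonneg_of_nonpos (abs_nonneg q) (Real.log_nonpos hκ.le hκ1))) hlog2.le
  refine ⟨-C, eventually_map.2 ?_⟩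
  filter_upwards [eventually_ge_atTop 1] with n hn
  have hden := mul_log_two_le_log_scale_inv hc n
  have hn0 : (0 : ℝ) < n := by exact_mod_cast hn
  have hnum : n * (|q| * Real.log κ) ≤
      Real.log (∏ i ∈ Finset.range n, powSum (digitWeight c₁ c₂ T a b) q i) := by
    have h := pow_le_prod_range (by positivity) (rpow_abs_le_powSum hc hκ hp hp1 q) n
    have := Real.log_le_log (by positivity) h
    rwa [Real.log_pow, Real.log_rpow hκ] at this
  rw [tauN_eq fun n i => hκ.trans_le (hp n i), ge_iff_le,
    le_div_iff₀ (lt_of_lt_of_le (by positivity) hden)]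
  have hCmul : C * Real.log 2 = -(|q| * Real.log κ) := div_mul_cancel₀ _ hlog2.ne'
  have := mul_le_mul_of_nonneg_left hden hC
  nlinarith

lemma frequently_one_le_of_lt_limsup (hc₁ : 2 ≤ c₁) (hc₂ : 2 ≤ c₂)
    (ha : ∀ i, i < c₁ → 0 < a i ∧ a i < 1) (hb : ∀ j, j < c₂ → 0 < b j ∧ b j < 1) {q s : ℝ}
    (hs : s < Filter.limsup (tauN c₁ c₂ T a b q) atTop) :
    ∃ᶠ n in atTop, 1 ≤ (∏ i ∈ Finset.range n, powSum (digitWeight c₁ c₂ T a b) q i) *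
      scale (Yc c₁ c₂ T) n ^ s := by
  have hc := two_le_Yc (T := T) hc₁ hc₂
  have hpos := fun n i => (digitWeight_mem_Ioo (T := T) ha hb n i).1
  have hfreq := frequently_lt_of_lt_limsup
    (isBoundedUnder_ge_tauN hc₁ hc₂ ha hb q).isCoboundedUnder_le hs
  refine (hfreq.and_eventually (eventually_ge_atTop 1)).mono fun n ⟨h, hn⟩ => ?_
  have hn0 : (0 : ℝ) < n := by exact_mod_cast hn
  have hsc := scale_pos hc n
  have hden : 0 < Real.log (scale (Yc c₁ c₂ T) n)⁻¹ :=
    lt_of_lt_of_le (mul_pos hn0 (Real.log_pos one_lt_two)) (mul_log_two_le_log_scale_inv hc n)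
  have hZ : 0 < ∏ i ∈ Finset.range n, powSum (digitWeight c₁ c₂ T a b) q i :=
    Finset.prod_pos fun i _ => powSum_pos hc hpos q i
  rw [tauN_eq hpos, lt_div_iff₀ hden, Real.log_inv] at h
  rw [← Real.log_nonneg_iff (by positivity), Real.log_mul hZ.ne' (by positivity),
    Real.log_rpow hsc]
  linarith

end Multinomial

/-- `𝓟^{q, τ_μ(q)-ε}_ν([0,1]) > 0`, hence `B_ν(q) ≥ τ_μ(q)`. -/
theorem stmt12 (c₁ c₂ : ℕ) (hc₁ : 2 ≤ c₁) (hc₂ : 2 ≤ c₂)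
    (T : ℕ → ℕ) (hT1 : T 1 = 1) (hTmono : ∀ k, 1 ≤ k → T k < T (k + 1))
    (hTrat : Tendsto (fun k => (T (k + 1) : ℝ) / (T k : ℝ)) atTop atTop)
    (a b : ℕ → ℝ) (ha : ∀ i, i < c₁ → 0 < a i ∧ a i < 1)
    (hb : ∀ j, j < c₂ → 0 < b j ∧ b j < 1)
    (hsa : ∑ i ∈ Finset.range c₁, a i = 1) (hsb : ∑ j ∈ Finset.range c₂, b j = 1)
    (μ : Measure (Omg c₁ c₂ T)) [IsProbabilityMeasure μ]
    (hμ : ∀ (n : ℕ) (w : Word c₁ c₂ T n),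
      μ (cyl c₁ c₂ T n w) = ENNReal.ofReal (cylWeight c₁ c₂ T a b n w))
    (q ε : ℝ) (hε : 0 < ε) :
    0 < Pmeas (μ.map (gammaMap c₁ c₂ T)) q
        (Filter.limsup (tauN c₁ c₂ T a b q) atTop - ε) (Set.Icc (0 : ℝ) 1) ∧
    Filter.limsup (tauN c₁ c₂ T a b q) atTop ≤ BFun (μ.map (gammaMap c₁ c₂ T)) q := by
  obtain ⟨κ, hκ, hp⟩ := exists_le_digitWeight T ha hb
  have hp1 := fun n i => (digitWeight_mem_Ioo (T := T) ha hb n i).2.le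
  have hc := two_le_Yc (T := T) hc₁ hc₂
  have hκ1 : κ ≤ 1 := (hp 0 ⟨0, by have := hc 0; omega⟩).trans (hp1 _ _)
  have hμ' : ∀ (x : Omg c₁ c₂ T) n, μ {y | ∀ i < n, y i = x i} =
      ENNReal.ofReal (∏ i ∈ Finset.range n, digitWeight c₁ c₂ T a b i (x i)) := fun x n => by
    rw [← Fin.prod_univ_eq_prod_range fun i => digitWeight c₁ c₂ T a b i (x i)]
    refine Eq.trans (congrArg μ ?_) (hμ n fun i => x i)
    ext y
    exact ⟨fun h i => h i i.2, fun h i hi => h ⟨i, hi⟩⟩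
  rw [gammaMap_eq_expansion]
  have htop : ∀ t < Filter.limsup (tauN c₁ c₂ T a b q) atTop, ∀ E : Set ℝ,
      Set.range (expansion : Omg c₁ c₂ T → ℝ) ⊆ E → Pmeas (μ.map expansion) q t E = ⊤ := by
    intro t ht E hE
    obtain ⟨s, hts, hs⟩ := exists_between ht
    exact Pmeas_map_expansion_eq_top hc Yc_le_max hκ hp hp1 hμ' hts
      (frequently_one_le_of_lt_limsup hc₁ hc₂ ha hb hs) hE
  constructor
  · rw [htop _ (sub_lt_self _ hε) _ ?_]
    · exact ENNReal.zero_lt_top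
    · rintro _ ⟨x, rfl⟩
      have h0 := prefixSum_le_expansion hc x 0
      have h1 := expansion_le_prefixSum_add_scale hc x 0
      simp only [prefixSum, scale, Finset.range_zero, Finset.sum_empty, Finset.prod_empty,
        zero_add] at h0 h1
      exact ⟨h0, h1⟩
  · refine le_csInf (exists_Pmeas_msupport_eq_zero hc hκ hκ1 hp hμ' q) fun t ht => ?_
    by_contra! hlt
    have := htop t hlt _
      (range_expansion_subset_msupport hc (fun n i => hκ.trans_le (hp n i)) hμ')
    exact ENNReal.top_ne_zero (this.symm.trans ht)

end MF
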